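/- Consider the sparse linear regression model with all quantities k=k_n, p=p_n, τ=τ_n, σ=σ_n depending on n and asymptotics as n→∞. Assume k/p → 0 and k/n → 0. In Regime I where τ/σ → 0, the minimax risk satisfies R(Θ(k,τ), σ) = kτ²·(1 − (kτ²/(pσ²))·(1+o(1))); equivalently, (1 − R(Θ(k,τ),σ)/(kτ²)) · (pσ²/(kτ²)) → 1. -/

import Mathlib

open MeasureTheory ProbabilityTheory Filter
open scoped NNReal ENNReal

noncomputable section

/-- Joint law of the data: a design matrix with i.i.d. `N(0, (1/n) I_p)` rows
(entries i.i.d. `N(0, 1/n)`) and an independent noise vector with i.i.d. `N(0,1)` entries. -/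
def model (n p : ℕ) : Measure ((Fin n → Fin p → ℝ) × (Fin n → ℝ)) :=
  (Measure.pi fun _ : Fin n => Measure.pi fun _ : Fin p => gaussianReal 0 (n : ℝ≥0)⁻¹).prod
    (Measure.pi fun _ : Fin n => gaussianReal 0 1)

/-- Expected squared-error risk `E_β ‖est(X, Xβ + σ z) − β‖₂²` of an estimator `est`
under the true parameter `β` and noise level `σ`. -/
def risk (n p : ℕ) (σ : ℝ)
    (est : (Fin n → Fin p → ℝ) × (Fin n → ℝ) → Fin p → ℝ) (β : Fin p → ℝ) : ℝ≥0∞ :=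
  ∫⁻ ω, ENNReal.ofReal
      (∑ j, (est (ω.1, fun i => (∑ l, ω.1 i l * β l) + σ * ω.2 i) j - β j) ^ 2) ∂ model n p

/-- The `ℓ₀` norm: number of nonzero coordinates. -/
def l0norm {p : ℕ} (β : Fin p → ℝ) : ℕ := (Finset.univ.filter fun j => β j ≠ 0).card

/-- The SNR-aware sparse parameter space `Θ(k, τ)`. -/
def Theta (p k : ℕ) (τ : ℝ) : Set (Fin p → ℝ) :=
  {β | l0norm β ≤ k ∧ ∑ j, β j ^ 2 ≤ k * τ ^ 2}

/-- The minimax risk `R(Θ(k,τ), σ)`: infimum over measurable estimators of the supremum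
risk over `Θ(k,τ)`. -/
def minimaxRisk (n p k : ℕ) (τ σ : ℝ) : ℝ≥0∞ :=
  ⨅ (est : (Fin n → Fin p → ℝ) × (Fin n → ℝ) → Fin p → ℝ) (_ : Measurable est),
    ⨆ β ∈ Theta p k τ, risk n p σ est β

lemma lintegral_pi_prod {ι : Type*} [Fintype ι] {Ω : ι → Type*} [∀ i, MeasurableSpace (Ω i)]
    (μ : ∀ i, Measure (Ω i)) [∀ i, IsProbabilityMeasure (μ i)]
    {f : ∀ i, Ω i → ℝ≥0∞} (hf : ∀ i, Measurable (f i)) :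
    ∫⁻ x, ∏ i, f i (x i) ∂Measure.pi μ = ∏ i, ∫⁻ x, f i x ∂μ i := by
  have h := lintegral_prod_eq_prod_lintegral_of_indepFun Finset.univ (μ := Measure.pi μ)
    (fun i x => f i (x i)) (iIndepFun_pi fun i => (hf i).aemeasurable)
    (fun i => (hf i).comp (measurable_pi_apply i))
  rw [h]
  refine Finset.prod_congr rfl fun i _ => ?_
  exact (measurePreserving_eval μ i).lintegral_comp (hf i)

lemma gaussianReal_eq_withDensity (v : ℝ) :
    gaussianReal v 1 =
      (gaussianReal 0 1).withDensity fun z => ENNReal.ofReal (Real.exp (v * z - v ^ 2 / 2)) := by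
  rw [gaussianReal_of_var_ne_zero _ one_ne_zero, gaussianReal_of_var_ne_zero _ one_ne_zero,
    ← withDensity_mul _ (measurable_gaussianPDF _ _) (by fun_prop)]
  congr 1
  ext z
  simp only [gaussianPDF, Pi.mul_apply, gaussianPDFReal]
  rw [← ENNReal.ofReal_mul (by positivity), mul_assoc (_)⁻¹, ← Real.exp_add]
  congr 3
  push_cast
  ring

lemma pi_gaussianReal_eq_withDensity {n : ℕ} (v : Fin n → ℝ) :
    (Measure.pi fun i => gaussianReal (v i) 1) =
      (Measure.pi fun _ : Fin n => gaussianReal 0 1).withDensity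
        fun z => ENNReal.ofReal (Real.exp (∑ i, v i * z i - (∑ i, v i ^ 2) / 2)) := by
  refine Measure.pi_eq fun s hs => ?_
  rw [withDensity_apply _ (MeasurableSet.univ_pi hs),
    ← lintegral_indicator (MeasurableSet.univ_pi hs)]
  have h : ∀ z : Fin n → ℝ, (Set.univ.pi s).indicator
      (fun z => ENNReal.ofReal (Real.exp (∑ i, v i * z i - (∑ i, v i ^ 2) / 2))) z =
      ∏ i, (s i).indicator
        (fun z => ENNReal.ofReal (Real.exp (v i * z - v i ^ 2 / 2))) (z i) := by
    intro z
    by_cases hz : z ∈ Set.univ.pi s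
    · rw [Set.indicator_of_mem hz, Finset.prod_congr rfl fun i _ =>
        Set.indicator_of_mem (hz i (Set.mem_univ i)) _,
        ← ENNReal.ofReal_prod_of_nonneg fun _ _ => (Real.exp_pos _).le, ← Real.exp_sum,
        Finset.sum_sub_distrib, Finset.sum_div]
    · rw [Set.indicator_of_notMem hz]
      simp only [Set.mem_univ_pi, not_forall] at hz
      obtain ⟨i, hi⟩ := hz
      exact (Finset.prod_eq_zero (Finset.mem_univ i) (Set.indicator_of_notMem hi _)).symm
  simp_rw [h]
  rw [lintegral_pi_prod _ fun i => Measurable.indicator (by fun_prop) (hs i)]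
  refine Finset.prod_congr rfl fun i _ => ?_
  rw [lintegral_indicator (hs i), gaussianReal_eq_withDensity (v i), withDensity_apply _ (hs i)]

lemma lintegral_gaussian_shift {n : ℕ} (v : Fin n → ℝ) {f : (Fin n → ℝ) → ℝ≥0∞}
    (hf : Measurable f) :
    ∫⁻ z, f (fun i => v i + z i) ∂(Measure.pi fun _ : Fin n => gaussianReal 0 1) =
      ∫⁻ z, ENNReal.ofReal (Real.exp (∑ i, v i * z i - (∑ i, v i ^ 2) / 2)) * f z
        ∂(Measure.pi fun _ : Fin n => gaussianReal 0 1) := by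
  have h := Measure.pi_map_pi (μ := fun _ : Fin n => gaussianReal 0 1)
    (f := fun i z => v i + z) (fun i => by fun_prop)
  simp only [gaussianReal_map_const_add, zero_add] at h
  rw [← lintegral_map (f := f) (g := fun (z : Fin n → ℝ) i => v i + z i) hf (by fun_prop), h,
    pi_gaussianReal_eq_withDensity, lintegral_withDensity_eq_lintegral_mul _ (by fun_prop) hf]
  rfl

lemma lintegral_exp_linear {n : ℕ} (v : Fin n → ℝ) :
    ∫⁻ z, ENNReal.ofReal (Real.exp (∑ i, v i * z i - (∑ i, v i ^ 2) / 2))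
      ∂(Measure.pi fun _ : Fin n => gaussianReal 0 1) = 1 := by
  have h := lintegral_gaussian_shift v (f := fun _ => 1) measurable_const
  simpa using h.symm

lemma lintegral_exp_sq_gaussianReal {v : ℝ≥0} {t : ℝ} (ht : 2 * t * v < 1) :
    ∫⁻ x, ENNReal.ofReal (Real.exp (t * x ^ 2)) ∂gaussianReal 0 v =
      ENNReal.ofReal ((1 - 2 * t * v) ^ (-(1 / 2) : ℝ)) := by
  rcases eq_or_ne v 0 with rfl | hv
  · simp
  have hv' : (0 : ℝ) < v := by positivity
  have hd : 0 < 1 - 2 * t * v := by linarith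
  have hq : (v : ℝ) / (1 - 2 * t * v) > 0 := by positivity
  set w : ℝ≥0 := ⟨v / (1 - 2 * t * v), hq.le⟩ with hw
  have hw0 : w ≠ 0 := fun h => hq.ne' (congrArg NNReal.toReal h)
  have key : ∀ x, gaussianPDF 0 v x * ENNReal.ofReal (Real.exp (t * x ^ 2)) =
      ENNReal.ofReal ((1 - 2 * t * v) ^ (-(1 / 2) : ℝ)) * gaussianPDF 0 w x := by
    intro x
    simp only [gaussianPDF, gaussianPDFReal]
    rw [← ENNReal.ofReal_mul (by positivity), ← ENNReal.ofReal_mul (by positivity)]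
    congr 1
    have hwr : (w : ℝ) = v / (1 - 2 * t * v) := rfl
    rw [hwr, Real.rpow_neg hd.le, ← Real.sqrt_eq_rpow, mul_assoc, ← Real.exp_add, ← mul_assoc]
    congr 1
    · rw [← mul_inv, ← Real.sqrt_mul hd.le]
      congr 2
      have : 1 - 2 * v * t ≠ 0 := by linarith
      field_simp
    · congr 1
      field_simp
      ring
  rw [gaussianReal_of_var_ne_zero _ hv,
    lintegral_withDensity_eq_lintegral_mul _ (measurable_gaussianPDF _ _) (by fun_prop)]
  simp only [Pi.mul_apply, key]
  rw [lintegral_const_mul _ (measurable_gaussianPDF _ _), lintegral_gaussianPDF_eq_one _ hw0,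
    mul_one]

lemma lintegral_exp_sum_sq_le {n : ℕ} (hn : 2 ≤ n) {t : ℝ} (ht : t < 1) :
    ∫⁻ x, ENNReal.ofReal (Real.exp (t * ∑ i, x i ^ 2))
      ∂(Measure.pi fun _ : Fin n => gaussianReal 0 (n : ℝ≥0)⁻¹) ≤ ENNReal.ofReal (1 - t)⁻¹ := by
  have hn' : (2 : ℝ) ≤ n := by exact_mod_cast hn
  have hd : 2 * t * ((n : ℝ≥0)⁻¹ : ℝ≥0) < 1 := by
    push_cast
    rw [← div_eq_mul_inv, div_lt_one (by linarith)]
    linarith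
  have h : ∀ x : Fin n → ℝ, ENNReal.ofReal (Real.exp (t * ∑ i, x i ^ 2)) =
      ∏ i, ENNReal.ofReal (Real.exp (t * x i ^ 2)) := fun x => by
    rw [← ENNReal.ofReal_prod_of_nonneg fun _ _ => (Real.exp_pos _).le, ← Real.exp_sum,
      Finset.mul_sum]
  simp_rw [h]
  rw [lintegral_pi_prod (f := fun _ x => ENNReal.ofReal (Real.exp (t * x ^ 2))) _
    fun i => by fun_prop]
  simp_rw [lintegral_exp_sq_gaussianReal hd]
  have hc : 0 < 1 - 2 * t * ((n : ℝ≥0)⁻¹ : ℝ≥0) := by linarith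
  rw [Finset.prod_const, Finset.card_univ, Fintype.card_fin, ← ENNReal.ofReal_pow (by positivity)]
  refine ENNReal.ofReal_le_ofReal ?_
  rw [← Real.rpow_natCast, ← Real.rpow_mul hc.le,
    show (-(1 / 2) : ℝ) * n = -((n : ℝ) / 2) by ring, Real.rpow_neg hc.le]
  refine inv_anti₀ (by linarith) ?_
  have hb := one_add_mul_self_le_rpow_one_add (s := -(2 * t * ((n : ℝ≥0)⁻¹ : ℝ≥0))) (by linarith)
    (p := (n : ℝ) / 2) (by linarith)
  rw [← sub_eq_add_neg 1 (2 * t * _)] at hb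
  refine le_trans (le_of_eq ?_) hb
  push_cast
  field_simp
  ring

/-- The sign `±1` encoded by a Boolean. -/
def boolSign (s : Bool) : ℝ := cond s 1 (-1)

@[simp] lemma boolSign_true : boolSign true = 1 := rfl

@[simp] lemma boolSign_false : boolSign false = -1 := rfl

lemma sum_sq_sub_single {m : ℕ} (g : Fin m → ℝ) (j : Fin m) (c : ℝ) :
    ∑ i, (g i - if i = j then c else 0) ^ 2 = ∑ i, g i ^ 2 - 2 * c * g j + c ^ 2 := by
  have h : ∀ i, (g i - if i = j then c else 0) ^ 2 =
      g i ^ 2 + if i = j then - 2 * c * g j + c ^ 2 else 0 := by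
    intro i
    split_ifs with hi
    · subst hi; ring
    · ring
  simp_rw [h, Finset.sum_add_distrib, Finset.sum_ite_eq' Finset.univ j]
  simp only [Finset.mem_univ, if_true]
  ring

lemma card_sq_le_sum_mul_sum_inv {m : ℕ} {q : Fin m → ℝ} (hq : ∀ j, 0 < q j) :
    (m : ℝ) ^ 2 ≤ (∑ j, q j) * ∑ j, (q j)⁻¹ := by
  have h := Finset.sum_mul_sq_le_sq_mul_sq Finset.univ
    (fun j => √(q j)) (fun j => √(q j)⁻¹)
  have h1 : ∀ j, √(q j) * √(q j)⁻¹ = 1 := fun j => by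
    rw [← Real.sqrt_mul (hq j).le, mul_inv_cancel₀ (hq j).ne', Real.sqrt_one]
  simp_rw [h1, fun j => Real.sq_sqrt (hq j).le, fun j => Real.sq_sqrt (inv_pos.2 (hq j)).le] at h
  simpa using h

/-- Pointwise lower bound for the weighted squared losses over signed spikes. -/
lemma weighted_spike_loss_ge {m : ℕ} (hm : 0 < m) {q : Fin m → ℝ} (hq : ∀ j, 0 < q j)
    {L : Fin m → Bool → ℝ} (hLq : ∀ j, 2 * q j ≤ L j true + L j false)
    (g : Fin m → ℝ) (τ : ℝ) :
    τ ^ 2 * ∑ j, ∑ s, L j s ≤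
      ∑ j, ∑ s, L j s * ∑ i, (g i - if i = j then boolSign s * τ else 0) ^ 2 +
        τ ^ 2 * ((∑ j, (q j)⁻¹) / (2 * m ^ 2)) * ∑ j, (L j true - L j false) ^ 2 := by
  set T := ∑ j, ∑ s, L j s with hT
  set K := (∑ j, (q j)⁻¹) / (2 * (m : ℝ) ^ 2) with hK
  have hm' : (0 : ℝ) < m := by exact_mod_cast hm
  have : Nonempty (Fin m) := ⟨⟨0, hm⟩⟩
  have hTq : 2 * ∑ j, q j ≤ T := by
    rw [hT, Finset.mul_sum]
    exact Finset.sum_le_sum fun j _ => by simpa using hLq j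
  have hTpos : 0 < T :=
    lt_of_lt_of_le (mul_pos two_pos (Finset.sum_pos (fun j _ => hq j) Finset.univ_nonempty)) hTq
  have hqi : 0 < ∑ j, (q j)⁻¹ :=
    Finset.sum_pos (fun j _ => inv_pos.2 (hq j)) Finset.univ_nonempty
  have hTK : 1 ≤ T * K := by
    rw [hK, mul_div_assoc', le_div_iff₀ (by positivity)]
    have := card_sq_le_sum_mul_sum_inv hq
    nlinarith
  have hexp : ∑ j, ∑ s, L j s * ∑ i, (g i - if i = j then boolSign s * τ else 0) ^ 2 =
      T * ∑ j, g j ^ 2 - 2 * τ * ∑ j, (L j true - L j false) * g j + τ ^ 2 * T := by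
    simp_rw [sum_sq_sub_single]
    rw [hT]
    simp only [Fintype.sum_bool, boolSign_true, boolSign_false]
    rw [Finset.mul_sum (a := 2 * τ), Finset.mul_sum (a := τ ^ 2),
      Finset.sum_mul, ← Finset.sum_sub_distrib, ← Finset.sum_add_distrib]
    refine Finset.sum_congr rfl fun j _ => ?_
    ring
  rw [hexp]
  have hsq : 0 ≤ ∑ j, (T * g j ^ 2 - 2 * τ * ((L j true - L j false) * g j) +
      τ ^ 2 * K * (L j true - L j false) ^ 2) := by
    refine Finset.sum_nonneg fun j _ => ?_
    set M := L j true - L j false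
    have h1 : 0 ≤ T * (T * g j ^ 2 - 2 * τ * (M * g j) + τ ^ 2 * K * M ^ 2) := by
      have h2 : T * (T * g j ^ 2 - 2 * τ * (M * g j) + τ ^ 2 * K * M ^ 2) =
        (T * g j - τ * M) ^ 2 + (T * K - 1) * (τ * M) ^ 2 := by ring
      rw [h2]
      have : 0 ≤ T * K - 1 := by linarith
      positivity
    exact nonneg_of_mul_nonneg_right h1 hTpos
  rw [Finset.sum_add_distrib, Finset.sum_sub_distrib, ← Finset.mul_sum, ← Finset.mul_sum,
    ← Finset.mul_sum] at hsq
  linarith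

/-- Second moment of the difference of the likelihood ratios of two opposite mean shifts. -/
lemma lintegral_likelihood_sub_sq {n : ℕ} (v : Fin n → ℝ) :
    ∫⁻ z, ENNReal.ofReal ((Real.exp (∑ i, v i * z i - (∑ i, v i ^ 2) / 2) -
        Real.exp (∑ i, -v i * z i - (∑ i, v i ^ 2) / 2)) ^ 2)
      ∂(Measure.pi fun _ : Fin n => gaussianReal 0 1) =
      ENNReal.ofReal (2 * (Real.exp (∑ i, v i ^ 2) - Real.exp (-∑ i, v i ^ 2))) := by
  set S := ∑ i, v i ^ 2 with hS
  have hS0 : 0 ≤ S := Finset.sum_nonneg fun _ _ => sq_nonneg _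
  have hE : ∀ c : ℝ, c ^ 2 = 4 → ∫⁻ z, ENNReal.ofReal (Real.exp (∑ i, c * v i * z i - S))
      ∂(Measure.pi fun _ : Fin n => gaussianReal 0 1) = ENNReal.ofReal (Real.exp S) := by
    intro c hc
    have h := lintegral_exp_linear fun i => c * v i
    have h2 : (∑ i, (c * v i) ^ 2) / 2 = 2 * S := by
      simp_rw [mul_pow, ← Finset.mul_sum, hc, ← hS]; ring
    rw [h2] at h
    have h3 : ∀ z : Fin n → ℝ, ENNReal.ofReal (Real.exp (∑ i, c * v i * z i - S)) =
        ENNReal.ofReal (Real.exp S) *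
          ENNReal.ofReal (Real.exp (∑ i, c * v i * z i - 2 * S)) := fun z => by
      rw [← ENNReal.ofReal_mul (Real.exp_pos _).le, ← Real.exp_add]
      congr 2
      ring
    simp_rw [h3]
    rw [lintegral_const_mul _ (by fun_prop), h, mul_one]
  have key : ∀ z : Fin n → ℝ, ENNReal.ofReal ((Real.exp (∑ i, v i * z i - S / 2) -
        Real.exp (∑ i, -v i * z i - S / 2)) ^ 2) + ENNReal.ofReal (2 * Real.exp (-S)) =
      ENNReal.ofReal (Real.exp (∑ i, 2 * v i * z i - S)) +
        ENNReal.ofReal (Real.exp (∑ i, -2 * v i * z i - S)) := by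
    intro z
    rw [← ENNReal.ofReal_add (by positivity) (by positivity),
      ← ENNReal.ofReal_add (by positivity) (by positivity)]
    congr 1
    simp_rw [neg_mul, mul_assoc, Finset.sum_neg_distrib, ← Finset.mul_sum]
    set u := ∑ i, v i * z i
    rw [sub_sq, ← Real.exp_nat_mul, ← Real.exp_nat_mul, mul_assoc, ← Real.exp_add]
    push_cast
    ring_nf
  have h1 := lintegral_congr (μ := Measure.pi fun _ : Fin n => gaussianReal 0 1) key
  rw [lintegral_add_right _ (by fun_prop), lintegral_add_right _ (by fun_prop), lintegral_const,
    measure_univ, mul_one, hE 2 (by norm_num), hE (-2) (by norm_num),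
    ← ENNReal.ofReal_add (by positivity) (by positivity)] at h1
  have h2 : Real.exp S + Real.exp S =
      2 * (Real.exp S - Real.exp (-S)) + 2 * Real.exp (-S) := by ring
  rw [h2, ENNReal.ofReal_add _ (by positivity)] at h1
  · exact (ENNReal.add_left_inj ENNReal.ofReal_ne_top).1 h1
  · have := Real.exp_le_exp.2 (show -S ≤ S by linarith)
    linarith

/-- Chebyshev's sum inequality for the exponentials governing the spike Bayes risk. -/
lemma sum_exp_mul_sum_sinh_le {m : ℕ} (w : Fin m → ℝ) (hw : ∀ j, 0 ≤ w j) :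
    (∑ j, Real.exp (w j / 2)) * ∑ j, (Real.exp (w j) - Real.exp (-w j)) ≤
      m * ∑ j, (Real.exp (2 * w j) - 1) := by
  have hmono : Monovary (fun j => Real.exp (w j))
      fun j => Real.exp (w j) - Real.exp (-w j) := by
    intro i j hij
    by_contra h
    have h1 := Real.exp_lt_exp.1 (not_le.1 h)
    have h2 := Real.exp_le_exp.2 h1.le
    have h3 := Real.exp_le_exp.2 (neg_le_neg h1.le)
    simp only at hij
    linarith
  have h := hmono.sum_mul_sum_le_card_mul_sum
  rw [Fintype.card_fin] at h
  refine le_trans ?_ (h.trans (le_of_eq ?_))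
  · refine mul_le_mul_of_nonneg_right (Finset.sum_le_sum fun j _ => ?_)
      (Finset.sum_nonneg fun j _ => ?_)
    · exact Real.exp_le_exp.2 (by linarith [hw j])
    · have := Real.exp_le_exp.2 (show -w j ≤ w j by linarith [hw j])
      linarith
  · congr 1
    refine Finset.sum_congr rfl fun j _ => ?_
    rw [mul_sub, ← Real.exp_add, ← Real.exp_add, add_neg_cancel, Real.exp_zero, two_mul]

/-- Bayes risk lower bound for a single signed spike observed through a fixed design. -/
lemma spike_bayes_risk_ge {n m : ℕ} (hm : 0 < m) (x : Fin m → Fin n → ℝ) (μ τ : ℝ)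
    {g : (Fin n → ℝ) → Fin m → ℝ} (hg : Measurable g) :
    ENNReal.ofReal (2 * m * τ ^ 2) ≤
      ∑ j, ∑ s, ∫⁻ z, ENNReal.ofReal
        (∑ i, (g (fun r => boolSign s * μ * x j r + z r) i -
          if i = j then boolSign s * τ else 0) ^ 2)
        ∂(Measure.pi fun _ : Fin n => gaussianReal 0 1) +
      ENNReal.ofReal (τ ^ 2 / m * ∑ j, (Real.exp (2 * μ ^ 2 * ∑ r, x j r ^ 2) - 1)) := by
  set γ := Measure.pi fun _ : Fin n => gaussianReal 0 1 with hγ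
  set w : Fin m → ℝ := fun j => μ ^ 2 * ∑ r, x j r ^ 2 with hw
  have hw0 : ∀ j, 0 ≤ w j := fun j =>
    mul_nonneg (sq_nonneg _) (Finset.sum_nonneg fun _ _ => sq_nonneg _)
  have hwv : ∀ j s, ∑ r, (boolSign s * μ * x j r) ^ 2 = w j := by
    intro j s
    have : boolSign s ^ 2 = 1 := by cases s <;> simp
    simp_rw [mul_pow, ← Finset.mul_sum, this, one_mul, hw]
  set L : Fin m → Bool → (Fin n → ℝ) → ℝ :=
    fun j s z => Real.exp (∑ r, boolSign s * μ * x j r * z r - w j / 2) with hL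
  have hLm : ∀ j s, Measurable (L j s) := fun j s => by fun_prop
  have hgm : ∀ i, Measurable fun z => g z i := fun i => measurable_pi_iff.1 hg i
  set q : Fin m → ℝ := fun j => Real.exp (-(w j / 2)) with hq
  have hqinv : ∀ j, (q j)⁻¹ = Real.exp (w j / 2) := fun j => by
    rw [hq, ← Real.exp_neg, neg_neg]
  have hLq : ∀ z j, 2 * q j ≤ L j true z + L j false z := by
    intro z j
    simp only [hL, hq, boolSign_true, boolSign_false, neg_mul, one_mul, Finset.sum_neg_distrib]
    set u := ∑ r, μ * x j r * z r
    rw [sub_eq_add_neg, sub_eq_add_neg, Real.exp_add, Real.exp_add, ← add_mul]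
    refine mul_le_mul_of_nonneg_right ?_ (Real.exp_pos _).le
    have := Real.one_le_cosh u
    rw [Real.cosh_eq] at this
    linarith
  set K := (∑ j, (q j)⁻¹) / (2 * (m : ℝ) ^ 2) with hK
  have hK0 : 0 ≤ K := div_nonneg (Finset.sum_nonneg fun j _ => by rw [hqinv]; positivity)
    (by positivity)
  have hloss0 : ∀ z j s,
      0 ≤ ∑ i, (g z i - if i = j then boolSign s * τ else 0) ^ 2 := fun z j s =>
    Finset.sum_nonneg fun _ _ => sq_nonneg _
  have hpt : ∀ z, ENNReal.ofReal (τ ^ 2) * ∑ j, ∑ s, ENNReal.ofReal (L j s z) ≤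
      ∑ j, ∑ s, ENNReal.ofReal (L j s z) * ENNReal.ofReal
        (∑ i, (g z i - if i = j then boolSign s * τ else 0) ^ 2) +
      ENNReal.ofReal (τ ^ 2 * K) * ∑ j, ENNReal.ofReal ((L j true z - L j false z) ^ 2) := by
    intro z
    have h := ENNReal.ofReal_le_ofReal
      (weighted_spike_loss_ge hm (q := q) (L := fun j s => L j s z) (fun j => Real.exp_pos _)
        (hLq z) (g z) τ)
    have hL0 : ∀ j s, 0 ≤ L j s z := fun j s => (Real.exp_pos _).le
    rw [ENNReal.ofReal_mul (sq_nonneg _), ENNReal.ofReal_add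
        (Finset.sum_nonneg fun j _ => Finset.sum_nonneg fun s _ =>
          mul_nonneg (hL0 j s) (hloss0 z j s))
        (mul_nonneg (mul_nonneg (sq_nonneg _) hK0) (Finset.sum_nonneg fun _ _ => sq_nonneg _)),
      ENNReal.ofReal_mul (mul_nonneg (sq_nonneg _) hK0),
      ENNReal.ofReal_sum_of_nonneg fun j _ => Finset.sum_nonneg fun s _ => hL0 j s,
      ENNReal.ofReal_sum_of_nonneg fun j _ => Finset.sum_nonneg fun s _ =>
          mul_nonneg (hL0 j s) (hloss0 z j s),
      ENNReal.ofReal_sum_of_nonneg fun j _ => sq_nonneg _] at h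
    refine (le_of_eq ?_).trans (h.trans (le_of_eq ?_))
    · congr 1
      exact Finset.sum_congr rfl fun j _ =>
        (ENNReal.ofReal_sum_of_nonneg fun s _ => hL0 j s).symm
    · congr 1
      refine Finset.sum_congr rfl fun j _ => ?_
      rw [ENNReal.ofReal_sum_of_nonneg fun s _ => mul_nonneg (hL0 j s) (hloss0 z j s)]
      exact Finset.sum_congr rfl fun s _ => ENNReal.ofReal_mul (hL0 j s)
  have hI := lintegral_mono (μ := γ) hpt
  rw [lintegral_const_mul _ (by fun_prop),
    lintegral_add_right _ (by fun_prop), lintegral_const_mul _ (by fun_prop),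
    lintegral_finsetSum _ (fun j _ => by fun_prop),
    lintegral_finsetSum _ (fun j _ => by fun_prop),
    lintegral_finsetSum _ (fun j _ => by fun_prop)] at hI
  have hL1 : ∀ j s, ∫⁻ z, ENNReal.ofReal (L j s z) ∂γ = 1 := by
    intro j s
    have h := lintegral_exp_linear fun r => boolSign s * μ * x j r
    rwa [hwv] at h
  have hM : ∀ j, ∫⁻ z, ENNReal.ofReal ((L j true z - L j false z) ^ 2) ∂γ =
      ENNReal.ofReal (2 * (Real.exp (w j) - Real.exp (-w j))) := by
    intro j
    have h := lintegral_likelihood_sub_sq fun r => boolSign true * μ * x j r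
    rw [hwv] at h
    rw [← h]
    simp only [hL, boolSign_true, boolSign_false, neg_mul, one_mul]
    rfl
  have hS : ∀ j, ∫⁻ z, ∑ s, ENNReal.ofReal (L j s z) * ENNReal.ofReal
        (∑ i, (g z i - if i = j then boolSign s * τ else 0) ^ 2) ∂γ =
      ∑ s, ∫⁻ z, ENNReal.ofReal
        (∑ i, (g (fun r => boolSign s * μ * x j r + z r) i -
          if i = j then boolSign s * τ else 0) ^ 2) ∂γ := by
    intro j
    rw [lintegral_finsetSum _ fun s _ => by fun_prop]
    refine Finset.sum_congr rfl fun s _ => ?_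
    have h := lintegral_gaussian_shift (fun r => boolSign s * μ * x j r)
      (f := fun z => ENNReal.ofReal
        (∑ i, (g z i - if i = j then boolSign s * τ else 0) ^ 2)) (by fun_prop)
    rw [h, hwv]
  simp_rw [hM, hS] at hI
  have hT : ∀ j, ∫⁻ z, ∑ s, ENNReal.ofReal (L j s z) ∂γ = 2 := by
    intro j
    rw [lintegral_finsetSum _ fun s _ => by fun_prop]
    simp [hL1]
  simp_rw [hT] at hI
  refine (le_of_eq ?_).trans (hI.trans (add_le_add le_rfl ?_))
  · rw [Finset.sum_const, Finset.card_univ, Fintype.card_fin, nsmul_eq_mul,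
      show (2 : ℝ) * m * τ ^ 2 = τ ^ 2 * (m * 2) by ring, ENNReal.ofReal_mul (sq_nonneg _),
      ENNReal.ofReal_mul (by positivity), ENNReal.ofReal_natCast, ENNReal.ofReal_ofNat]
  · have hsinh : ∀ j, 0 ≤ 2 * (Real.exp (w j) - Real.exp (-w j)) := fun j => by
      have := Real.exp_le_exp.2 (show -w j ≤ w j by linarith [hw0 j])
      linarith
    rw [← ENNReal.ofReal_sum_of_nonneg fun j _ => hsinh j,
      ← ENNReal.ofReal_mul (mul_nonneg (sq_nonneg _) hK0)]
    refine ENNReal.ofReal_le_ofReal ?_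
    have hm' : (0 : ℝ) < m := by exact_mod_cast hm
    have h := sum_exp_mul_sum_sinh_le w hw0
    simp_rw [hK, hqinv, ← Finset.mul_sum]
    have e : ∀ j, 2 * μ ^ 2 * ∑ r, x j r ^ 2 = 2 * w j := fun j => by rw [hw]; ring
    simp_rw [e]
    calc _ = τ ^ 2 / m ^ 2 * ((∑ j, Real.exp (w j / 2)) *
          ∑ j, (Real.exp (w j) - Real.exp (-w j))) := by field_simp
      _ ≤ τ ^ 2 / m ^ 2 * (m * ∑ j, (Real.exp (2 * w j) - 1)) := by gcongr
      _ = _ := by field_simp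

instance (n p : ℕ) : IsProbabilityMeasure (model n p) := by
  unfold model; infer_instance

/-- The law of the design matrix. -/
def designLaw (n p : ℕ) : Measure (Fin n → Fin p → ℝ) :=
  Measure.pi fun _ : Fin n => Measure.pi fun _ : Fin p => gaussianReal 0 (n : ℝ≥0)⁻¹

instance (n p : ℕ) : IsProbabilityMeasure (designLaw n p) := by
  unfold designLaw; infer_instance

lemma lintegral_exp_column_sub_one_le {n p : ℕ} (hn : 2 ≤ n) {t : ℝ} (ht : t < 1) (ht0 : 0 ≤ t)
    (l : Fin p) :
    ∫⁻ X, ENNReal.ofReal (Real.exp (t * ∑ r, X r l ^ 2) - 1) ∂designLaw n p ≤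
      ENNReal.ofReal (t / (1 - t)) := by
  have hmap : (designLaw n p).map (fun X r => X r l) =
      Measure.pi fun _ : Fin n => gaussianReal 0 (n : ℝ≥0)⁻¹ := by
    have h := Measure.pi_map_pi
      (μ := fun _ : Fin n => Measure.pi fun _ : Fin p => gaussianReal 0 (n : ℝ≥0)⁻¹)
      (f := fun _ x => x l) (fun _ => (measurable_pi_apply l).aemeasurable)
    rw [designLaw, h]
    congr 1
    ext1 r
    exact (measurePreserving_eval (fun _ : Fin p => gaussianReal 0 (n : ℝ≥0)⁻¹) l).map_eq
  have h1 := lintegral_exp_sum_sq_le hn ht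
  rw [← hmap, lintegral_map (by fun_prop) (by fun_prop)] at h1
  have h2 : ∀ X : Fin n → Fin p → ℝ, ENNReal.ofReal (Real.exp (t * ∑ r, X r l ^ 2)) =
      ENNReal.ofReal (Real.exp (t * ∑ r, X r l ^ 2) - 1) + 1 := fun X => by
    have : 1 ≤ Real.exp (t * ∑ r, X r l ^ 2) :=
      Real.one_le_exp (mul_nonneg ht0 (Finset.sum_nonneg fun _ _ => sq_nonneg _))
    rw [← ENNReal.ofReal_one, ← ENNReal.ofReal_add (by linarith) zero_le_one, sub_add_cancel]
  simp_rw [h2] at h1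
  have h3 : (1 - t)⁻¹ = t / (1 - t) + 1 := by
    have : 1 - t ≠ 0 := by linarith
    field_simp
    ring
  have h4 : 0 ≤ t / (1 - t) := div_nonneg ht0 (by linarith)
  rw [lintegral_add_right _ measurable_const, lintegral_const, measure_univ, mul_one, h3,
    ENNReal.ofReal_add h4 zero_le_one, ENNReal.ofReal_one] at h1
  exact (ENNReal.add_le_add_iff_right ENNReal.one_ne_top).1 h1

/-- The signal with one signed spike of height `τ` in each block; `e (b, i)` is the `i`-th
coordinate of block `b`. -/
def spikeSignal {p k m : ℕ} (e : Fin k × Fin m → Fin p) (τ : ℝ) (θ : Fin k → Fin m × Bool) :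
    Fin p → ℝ :=
  fun l => ∑ b, if l = e (b, (θ b).1) then boolSign (θ b).2 * τ else 0

section spikeSignal

variable {p k m : ℕ} {e : Fin k × Fin m → Fin p}

lemma spikeSignal_apply (he : Function.Injective e) (τ : ℝ) (θ : Fin k → Fin m × Bool)
    (b : Fin k) (i : Fin m) :
    spikeSignal e τ θ (e (b, i)) = if i = (θ b).1 then boolSign (θ b).2 * τ else 0 := by
  unfold spikeSignal
  rw [Finset.sum_eq_single b]
  · simp [he.eq_iff]
  · intro b' _ hb'
    rw [if_neg]
    intro h
    exact hb' (congrArg Prod.fst (he h)).symm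
  · simp

lemma sum_mul_spikeSignal (τ : ℝ) (θ : Fin k → Fin m × Bool) (x : Fin p → ℝ) :
    ∑ l, x l * spikeSignal e τ θ l =
      ∑ b, x (e (b, (θ b).1)) * (boolSign (θ b).2 * τ) := by
  simp_rw [spikeSignal, Finset.mul_sum]
  rw [Finset.sum_comm]
  refine Finset.sum_congr rfl fun b _ => ?_
  simp

lemma spikeSignal_mem_Theta (he : Function.Injective e) (τ : ℝ) (θ : Fin k → Fin m × Bool) :
    spikeSignal e τ θ ∈ Theta p k τ := by
  constructor
  · unfold l0norm
    have hsub : (Finset.univ.filter fun j => spikeSignal e τ θ j ≠ 0) ⊆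
        Finset.univ.image fun b => e (b, (θ b).1) := by
      intro l hl
      by_contra hcon
      refine (Finset.mem_filter.1 hl).2 (Finset.sum_eq_zero fun b _ => if_neg ?_)
      rintro rfl
      exact hcon (Finset.mem_image_of_mem (fun b => e (b, (θ b).1)) (Finset.mem_univ b))
    refine (Finset.card_le_card hsub).trans (Finset.card_image_le.trans (by simp))
  · refine le_of_eq ?_
    simp_rw [pow_two (spikeSignal e τ θ _)]
    rw [sum_mul_spikeSignal]
    have : ∀ b, spikeSignal e τ θ (e (b, (θ b).1)) * (boolSign (θ b).2 * τ) = τ ^ 2 := by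
      intro b
      rw [spikeSignal_apply he, if_pos rfl]
      cases (θ b).2 <;> simp <;> ring
    simp [this]

end spikeSignal

lemma sum_sum_update_eq {k : ℕ} {C : Type*} [Fintype C] (b : Fin k)
    (f : (Fin k → C) → ℝ≥0∞) :
    ∑ θ, ∑ c, f (Function.update θ b c) = Fintype.card C * ∑ θ, f θ := by
  classical
  have hinv : Function.Involutive fun q : (Fin k → C) × C =>
      (Function.update q.1 b q.2, q.1 b) := by
    rintro ⟨θ, c⟩
    simp
  rw [← Fintype.sum_prod_type' fun θ c => f (Function.update θ b c)]
  rw [Fintype.sum_equiv hinv.toPerm (fun q : (Fin k → C) × C => f (Function.update q.1 b q.2))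
    (fun q => f q.1) fun q => rfl]
  rw [Fintype.sum_prod_type' fun θ (_ : C) => f θ]
  simp [Finset.mul_sum]

section lowerBound

variable {n p k m : ℕ}

/-- The part of the spike risk of `est` carried by the coordinates in block `b`. -/
def blockRisk (n : ℕ) (e : Fin k × Fin m → Fin p) (τ σ : ℝ)
    (est : (Fin n → Fin p → ℝ) × (Fin n → ℝ) → Fin p → ℝ) (b : Fin k)
    (θ : Fin k → Fin m × Bool) : ℝ≥0∞ :=
  ∫⁻ ω, ENNReal.ofReal
      (∑ i, (est (ω.1, fun r => (∑ l, ω.1 r l * spikeSignal e τ θ l) + σ * ω.2 r) (e (b, i)) -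
        spikeSignal e τ θ (e (b, i))) ^ 2) ∂ model n p

lemma sum_blockRisk_le_risk {e : Fin k × Fin m → Fin p} (he : Function.Injective e) (τ σ : ℝ)
    {est : (Fin n → Fin p → ℝ) × (Fin n → ℝ) → Fin p → ℝ} (hest : Measurable est)
    (θ : Fin k → Fin m × Bool) :
    ∑ b, blockRisk n e τ σ est b θ ≤ risk n p σ est (spikeSignal e τ θ) := by
  have hm : ∀ l, Measurable fun q => est q l := fun l => measurable_pi_iff.1 hest l
  unfold blockRisk risk
  rw [← lintegral_finsetSum _ fun b _ => by fun_prop]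
  refine lintegral_mono fun ω => ?_
  simp only
  rw [← ENNReal.ofReal_sum_of_nonneg fun b _ => Finset.sum_nonneg fun _ _ => sq_nonneg _]
  refine ENNReal.ofReal_le_ofReal ?_
  rw [← Fintype.sum_prod_type' fun b i => (est (ω.1, fun r =>
    (∑ l, ω.1 r l * spikeSignal e τ θ l) + σ * ω.2 r) (e (b, i)) -
        spikeSignal e τ θ (e (b, i))) ^ 2]
  refine (le_of_eq (Finset.sum_map Finset.univ ⟨e, he⟩ fun l => (est (ω.1, fun r =>
    (∑ l, ω.1 r l * spikeSignal e τ θ l) + σ * ω.2 r) l - spikeSignal e τ θ l) ^ 2).symm).trans ?_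
  exact Finset.sum_le_sum_of_subset_of_nonneg (Finset.subset_univ _) fun _ _ _ => sq_nonneg _

lemma sum_blockRisk_update_ge {e : Fin k × Fin m → Fin p} (he : Function.Injective e)
    (hn : 2 ≤ n) (hm : 0 < m) {τ σ : ℝ} (hσ : 0 < σ) (ha : 2 * (τ / σ) ^ 2 < 1)
    {est : (Fin n → Fin p → ℝ) × (Fin n → ℝ) → Fin p → ℝ} (hest : Measurable est)
    (b : Fin k) (θ : Fin k → Fin m × Bool) :
    ENNReal.ofReal (2 * m * τ ^ 2) ≤
      ∑ c, blockRisk n e τ σ est b (Function.update θ b c) +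
        ENNReal.ofReal (τ ^ 2 * (2 * (τ / σ) ^ 2 / (1 - 2 * (τ / σ) ^ 2))) := by
  set a := (τ / σ) ^ 2 with ha_def
  have ha0 : 0 ≤ a := sq_nonneg _
  have hm' : (0 : ℝ) < m := by exact_mod_cast hm
  have hestm : ∀ l, Measurable fun q => est q l := fun l => measurable_pi_iff.1 hest l
  have hoffset : ∀ (c : Fin m × Bool) (x : Fin p → ℝ) (z : ℝ),
      (∑ l, x l * spikeSignal e τ (Function.update θ b c) l) + σ * z =
        (∑ b' ∈ Finset.univ.erase b, x (e (b', (θ b').1)) * (boolSign (θ b').2 * τ)) +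
          σ * (boolSign c.2 * (τ / σ) * x (e (b, c.1)) + z) := by
    intro c x z
    rw [sum_mul_spikeSignal, ← Finset.add_sum_erase _ _ (Finset.mem_univ b),
      Finset.sum_congr rfl fun b' hb' => by
        rw [Function.update_of_ne (Finset.ne_of_mem_erase hb')]]
    rw [Function.update_self]
    field_simp
    ring
  have hsplit : ∀ c, blockRisk n e τ σ est b (Function.update θ b c) =
      ∫⁻ X, ∫⁻ z, ENNReal.ofReal (∑ i, (est (X, fun r =>
        (∑ b' ∈ Finset.univ.erase b, X r (e (b', (θ b').1)) * (boolSign (θ b').2 * τ)) +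
          σ * (boolSign c.2 * (τ / σ) * X r (e (b, c.1)) + z r)) (e (b, i)) -
        if i = c.1 then boolSign c.2 * τ else 0) ^ 2)
        ∂(Measure.pi fun _ : Fin n => gaussianReal 0 1) ∂designLaw n p := by
    intro c
    unfold blockRisk model
    simp_rw [spikeSignal_apply he, Function.update_self, hoffset]
    rw [lintegral_prod _ (by fun_prop)]
    rfl
  have hX : ∀ X : Fin n → Fin p → ℝ, ENNReal.ofReal (2 * m * τ ^ 2) ≤
      ∑ c : Fin m × Bool, ∫⁻ z, ENNReal.ofReal (∑ i, (est (X, fun r =>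
        (∑ b' ∈ Finset.univ.erase b, X r (e (b', (θ b').1)) * (boolSign (θ b').2 * τ)) +
          σ * (boolSign c.2 * (τ / σ) * X r (e (b, c.1)) + z r)) (e (b, i)) -
        if i = c.1 then boolSign c.2 * τ else 0) ^ 2)
        ∂(Measure.pi fun _ : Fin n => gaussianReal 0 1) +
      ENNReal.ofReal (τ ^ 2 / m) *
        ∑ j, ENNReal.ofReal (Real.exp (2 * a * ∑ r, X r (e (b, j)) ^ 2) - 1) := by
    intro X
    have h := spike_bayes_risk_ge (n := n) hm (fun j r => X r (e (b, j))) (τ / σ) τ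
      (g := fun w i => est (X, fun r =>
        (∑ b' ∈ Finset.univ.erase b, X r (e (b', (θ b').1)) * (boolSign (θ b').2 * τ)) +
          σ * w r) (e (b, i))) (by fun_prop)
    rw [Fintype.sum_prod_type, ← ENNReal.ofReal_sum_of_nonneg,
      ← ENNReal.ofReal_mul (by positivity)]
    · exact h
    · intro j _
      have : 1 ≤ Real.exp (2 * a * ∑ r, X r (e (b, j)) ^ 2) := Real.one_le_exp (by positivity)
      linarith
  have hI := lintegral_mono (μ := designLaw n p) hX
  rw [lintegral_const, measure_univ, mul_one, lintegral_add_right _ (by fun_prop),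
    lintegral_const_mul _ (by fun_prop), lintegral_finsetSum _ fun j _ => by fun_prop,
    lintegral_finsetSum _ fun j _ => by fun_prop] at hI
  simp_rw [hsplit]
  refine hI.trans (add_le_add le_rfl ?_)
  calc _ ≤ ENNReal.ofReal (τ ^ 2 / m) *
        ∑ _j : Fin m, ENNReal.ofReal (2 * a / (1 - 2 * a)) := by
        gcongr with j
        exact lintegral_exp_column_sub_one_le hn ha (by positivity) _
    _ = _ := by
        rw [Finset.sum_const, Finset.card_univ, Fintype.card_fin, nsmul_eq_mul,
          ← ENNReal.ofReal_natCast, ← ENNReal.ofReal_mul (by positivity),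
          ← ENNReal.ofReal_mul (by positivity)]
        congr 1
        field_simp

/-- Lower bound on the minimax risk from independent signed spikes in `k` blocks of length `m`. -/
theorem minimaxRisk_ge (hn : 2 ≤ n) (hm : 0 < m) (hkm : k * m ≤ p) {τ σ : ℝ} (hσ : 0 < σ)
    (ha : 2 * (τ / σ) ^ 2 < 1) :
    ENNReal.ofReal (k * τ ^ 2 * (1 - (τ / σ) ^ 2 / (m * (1 - 2 * (τ / σ) ^ 2)))) ≤
      minimaxRisk n p k τ σ := by
  unfold _root_.minimaxRisk
  refine le_iInf₂ fun est hest => ?_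
  set R := ⨆ β ∈ Theta p k τ, risk n p σ est β with hR
  set e : Fin k × Fin m → Fin p := fun q => Fin.castLE hkm (finProdFinEquiv q) with he_def
  have he : Function.Injective e :=
    (Fin.castLE_injective hkm).comp finProdFinEquiv.injective
  have : Nonempty (Fin m) := ⟨⟨0, hm⟩⟩
  set a := (τ / σ) ^ 2 with ha_def
  have ha0 : 0 ≤ a := sq_nonneg _
  have hm' : (0 : ℝ) < m := by exact_mod_cast hm
  set N : ℝ≥0∞ := ((Fintype.card (Fin k → Fin m × Bool) : ℕ) : ℝ≥0∞) with hN
  have hN0 : N ≠ 0 := by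
    rw [hN, Nat.cast_ne_zero]
    exact Fintype.card_ne_zero
  have hNt : N ≠ ∞ := ENNReal.natCast_ne_top _
  have h1 : ∑ θ, ∑ b, blockRisk n e τ σ est b θ ≤ N * R := by
    calc _ ≤ ∑ _θ : Fin k → Fin m × Bool, R := Finset.sum_le_sum fun θ _ =>
          (sum_blockRisk_le_risk he τ σ hest θ).trans
            (le_iSup₂_of_le _ (spikeSignal_mem_Theta he τ θ) le_rfl)
      _ = N * R := by rw [Finset.sum_const, nsmul_eq_mul, Finset.card_univ, hN]
  have h2 : ∀ b, N * ENNReal.ofReal (2 * m * τ ^ 2) ≤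
      2 * m * ∑ θ, blockRisk n e τ σ est b θ +
        N * ENNReal.ofReal (τ ^ 2 * (2 * a / (1 - 2 * a))) := by
    intro b
    have h := Finset.sum_le_sum fun θ (_ : θ ∈ Finset.univ) =>
      sum_blockRisk_update_ge he hn hm hσ ha hest b θ
    rw [Finset.sum_add_distrib, sum_sum_update_eq, Finset.sum_const, Finset.sum_const,
      nsmul_eq_mul, nsmul_eq_mul, Finset.card_univ] at h
    refine h.trans (le_of_eq ?_)
    congr 2
    simp [mul_comm]
  have h3 := Finset.sum_le_sum fun b (_ : b ∈ Finset.univ) => h2 b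
  rw [Finset.sum_add_distrib, ← Finset.mul_sum (a := (2 * m : ℝ≥0∞)), Finset.sum_comm,
    Finset.sum_const,
    Finset.sum_const, Finset.card_univ, Fintype.card_fin, nsmul_eq_mul, nsmul_eq_mul] at h3
  have h4 : N * (k * ENNReal.ofReal (2 * m * τ ^ 2)) ≤
      N * (2 * m * R + k * ENNReal.ofReal (τ ^ 2 * (2 * a / (1 - 2 * a)))) := by
    calc _ = k * (N * ENNReal.ofReal (2 * m * τ ^ 2)) := by ring
      _ ≤ 2 * m * (N * R) + k * (N * ENNReal.ofReal (τ ^ 2 * (2 * a / (1 - 2 * a)))) :=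
          h3.trans (by gcongr)
      _ = _ := by ring
  have h5 := (ENNReal.mul_le_mul_iff_right hN0 hNt).1 h4
  rcases eq_or_ne R ∞ with hRt | hRt
  · rw [hRt]; exact le_top
  have h1a : 0 < 1 - 2 * a := by linarith
  rw [← ENNReal.ofReal_toReal hRt, ← ENNReal.ofReal_natCast k, ← ENNReal.ofReal_natCast m,
    ← ENNReal.ofReal_ofNat 2, ← ENNReal.ofReal_mul (by positivity),
    ← ENNReal.ofReal_mul (by positivity), ← ENNReal.ofReal_mul (by positivity),
    ← ENNReal.ofReal_mul (by positivity), ← ENNReal.ofReal_add (by positivity) (by positivity),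
    ENNReal.ofReal_le_ofReal_iff (by positivity)] at h5
  refine ENNReal.ofReal_le_of_le_toReal ?_
  have h6 : (k : ℝ) * τ ^ 2 * (1 - a / (m * (1 - 2 * a))) =
      (k * (2 * m * τ ^ 2) - k * (τ ^ 2 * (2 * a / (1 - 2 * a)))) / (2 * m) := by
    field_simp
  rw [h6, div_le_iff₀ (by positivity)]
  linarith

end lowerBound

lemma integral_pow_four_gaussianReal_le (v : ℝ≥0) :
    ∫ x, x ^ 4 ∂gaussianReal 0 v ≤ 64 * (v : ℝ) ^ 2 := by
  rcases eq_or_ne v 0 with rfl | hv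
  · simp
  have hv' : (0 : ℝ) < v := by positivity
  have hpt : ∀ x : ℝ, ENNReal.ofReal (x ^ 4) ≤
      ENNReal.ofReal (32 * (v : ℝ) ^ 2) * ENNReal.ofReal (Real.exp ((4 * (v : ℝ))⁻¹ * x ^ 2)) := by
    intro x
    rw [← ENNReal.ofReal_mul (by positivity)]
    refine ENNReal.ofReal_le_ofReal ?_
    have h := Real.quadratic_le_exp_of_nonneg
      (show 0 ≤ (4 * (v : ℝ))⁻¹ * x ^ 2 by positivity)
    have h2 : 32 * (v : ℝ) ^ 2 * (((4 * (v : ℝ))⁻¹ * x ^ 2) ^ 2 / 2) = x ^ 4 := by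
      field_simp
      ring
    rw [← h2]
    gcongr
    have : 0 ≤ (4 * (v : ℝ))⁻¹ * x ^ 2 := by positivity
    linarith
  have ht : 2 * (4 * (v : ℝ))⁻¹ * v = 1 / 2 := by field_simp; norm_num
  have hsqrt : (1 - 2 * (4 * (v : ℝ))⁻¹ * v) ^ (-(1 / 2) : ℝ) ≤ 2 := by
    rw [ht]
    calc ((1 : ℝ) - 1 / 2) ^ (-(1 / 2) : ℝ) ≤ (1 - 1 / 2) ^ (-1 : ℝ) :=
          Real.rpow_le_rpow_of_exponent_ge (by norm_num) (by norm_num) (by norm_num)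
      _ = 2 := by rw [Real.rpow_neg_one]; norm_num
  have hle : ∫⁻ x, ENNReal.ofReal (x ^ 4) ∂gaussianReal 0 v ≤
      ENNReal.ofReal (64 * (v : ℝ) ^ 2) := by
    refine (lintegral_mono hpt).trans ?_
    rw [lintegral_const_mul _ (by fun_prop), lintegral_exp_sq_gaussianReal (by rw [ht]; norm_num),
      ← ENNReal.ofReal_mul (by positivity)]
    refine ENNReal.ofReal_le_ofReal ?_
    nlinarith [sq_nonneg (v : ℝ)]
  rw [integral_eq_lintegral_of_nonneg_ae (ae_of_all _ fun x => by positivity)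
    (by fun_prop)]
  exact ENNReal.toReal_le_of_le_ofReal (by positivity) hle

/-- The law of one row of the design matrix. -/
def rowLaw (n p : ℕ) : Measure (Fin p → ℝ) :=
  Measure.pi fun _ : Fin p => gaussianReal 0 (n : ℝ≥0)⁻¹

instance (n p : ℕ) : IsProbabilityMeasure (rowLaw n p) := by
  unfold rowLaw; infer_instance

section rowLaw

variable (n : ℕ) {p : ℕ}

lemma measurePreserving_eval_rowLaw (j : Fin p) :
    MeasurePreserving (fun x : Fin p → ℝ => x j) (rowLaw n p) (gaussianReal 0 (n : ℝ≥0)⁻¹) :=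
  measurePreserving_eval (fun _ : Fin p => gaussianReal 0 (n : ℝ≥0)⁻¹) j

lemma memLp_eval_rowLaw (j : Fin p) {q : ℝ≥0∞} (hq : q ≠ ∞) :
    MemLp (fun x : Fin p → ℝ => x j) q (rowLaw n p) :=
  (memLp_id_gaussianReal' q hq).comp_measurePreserving (measurePreserving_eval_rowLaw n j)

lemma memLp_linear_rowLaw (β : Fin p → ℝ) {q : ℝ≥0∞} (hq : q ≠ ∞) :
    MemLp (fun x : Fin p → ℝ => ∑ l, x l * β l) q (rowLaw n p) :=
  memLp_finsetSum _ fun l _ => (memLp_eval_rowLaw n l hq).mul_const (β l)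

lemma integral_eval_rowLaw (j : Fin p) : ∫ x, x j ∂rowLaw n p = 0 := by
  rw [rowLaw, integral_comp_eval (μ := fun _ : Fin p => gaussianReal 0 (n : ℝ≥0)⁻¹)
    (f := fun x => x) (by fun_prop)]
  exact integral_id_gaussianReal

lemma integral_eval_sq_rowLaw (j : Fin p) : ∫ x, x j ^ 2 ∂rowLaw n p = (n : ℝ)⁻¹ := by
  rw [rowLaw, integral_comp_eval (μ := fun _ : Fin p => gaussianReal 0 (n : ℝ≥0)⁻¹)
    (f := fun x => x ^ 2) (by fun_prop)]
  have h := variance_id_gaussianReal (μ := 0) (v := (n : ℝ≥0)⁻¹)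
  rw [variance_eq_sub (memLp_id_gaussianReal 2)] at h
  simpa using h

lemma integral_eval_mul_eval_rowLaw (j l : Fin p) :
    ∫ x, x j * x l ∂rowLaw n p = if l = j then (n : ℝ)⁻¹ else 0 := by
  split_ifs with h
  · subst h
    simp_rw [← pow_two, integral_eval_sq_rowLaw]
  · have hind : IndepFun (fun x : Fin p → ℝ => x j) (fun x => x l) (rowLaw n p) :=
      (iIndepFun_pi (μ := fun _ : Fin p => gaussianReal 0 (n : ℝ≥0)⁻¹) (X := fun _ => id)
        fun _ => aemeasurable_id).indepFun (Ne.symm h)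
    have := hind.integral_mul_eq_mul_integral
      (measurable_pi_apply j).aestronglyMeasurable (measurable_pi_apply l).aestronglyMeasurable
    simpa [integral_eval_rowLaw] using this

lemma integral_eval_mul_linear_rowLaw (β : Fin p → ℝ) (j : Fin p) :
    ∫ x, x j * ∑ l, x l * β l ∂rowLaw n p = β j / n := by
  simp_rw [Finset.mul_sum, ← mul_assoc]
  rw [integral_finsetSum]
  · simp_rw [integral_mul_const, integral_eval_mul_eval_rowLaw]
    simp [div_eq_inv_mul]
  · intro l _
    exact ((memLp_eval_rowLaw n j (q := 2) (by simp)).integrable_mul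
      (memLp_eval_rowLaw n l (q := 2) (by simp))).mul_const _

lemma map_linear_rowLaw (β : Fin p → ℝ) :
    (rowLaw n p).map (fun x => ∑ l, x l * β l) =
      gaussianReal 0 ((∑ l, β l ^ 2) / n).toNNReal := by
  have hgl : ∀ l, HasGaussianLaw (fun x : Fin p → ℝ => x l * β l) (rowLaw n p) := fun l => by
    have : HasGaussianLaw (fun x : Fin p → ℝ => x l) (rowLaw n p) :=
      ⟨by rw [(measurePreserving_eval_rowLaw n l).map_eq]; infer_instance⟩
    simpa [mul_comm] using this.fun_smul (β l)
  have hg : HasGaussianLaw (fun x : Fin p → ℝ => ∑ l, x l * β l) (rowLaw n p) :=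
    (iIndepFun_pi (μ := fun _ : Fin p => gaussianReal 0 (n : ℝ≥0)⁻¹)
      (X := fun l x => x * β l) fun _ => by fun_prop).hasGaussianLaw_fun_sum hgl
  rw [hg.map_eq_gaussianReal]
  congr 2
  · rw [integral_finsetSum _ fun l _ =>
      (memLp_one_iff_integrable.1 (memLp_eval_rowLaw n l (by simp))).mul_const _]
    simp [integral_mul_const, integral_eval_rowLaw]
  · have h := variance_sum_pi (μ := fun _ : Fin p => gaussianReal 0 (n : ℝ≥0)⁻¹)
      (X := fun l x => x * β l) fun l => (memLp_id_gaussianReal 2).mul_const (β l)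
    have hfun : (∑ l, fun x : Fin p → ℝ => x l * β l) = fun x => ∑ l, x l * β l := by
      ext x; simp
    rw [hfun] at h
    rw [rowLaw, h, Finset.sum_div]
    refine Finset.sum_congr rfl fun l _ => ?_
    rw [variance_mul_const, variance_fun_id_gaussianReal]
    simp [div_eq_inv_mul]

lemma integral_linear_pow_four_rowLaw_le (β : Fin p → ℝ) :
    ∫ x, (∑ l, x l * β l) ^ 4 ∂rowLaw n p ≤ 64 * ((∑ l, β l ^ 2) / n) ^ 2 := by
  have h := integral_pow_four_gaussianReal_le ((∑ l, β l ^ 2) / n).toNNReal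
  rw [← map_linear_rowLaw, integral_map
    (Measurable.aemeasurable (by fun_prop)) (by fun_prop), Real.coe_toNNReal _ (by positivity)] at h
  exact h

lemma integral_eval_pow_four_rowLaw_le (j : Fin p) :
    ∫ x, x j ^ 4 ∂rowLaw n p ≤ 64 * ((n : ℝ)⁻¹) ^ 2 := by
  have h := integral_pow_four_gaussianReal_le (n : ℝ≥0)⁻¹
  rw [rowLaw, integral_comp_eval (μ := fun _ : Fin p => gaussianReal 0 (n : ℝ≥0)⁻¹)
    (f := fun x => x ^ 4) (by fun_prop)]
  simpa using h

lemma integral_eval_mul_linear_sq_rowLaw_le (β : Fin p → ℝ) (j : Fin p) :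
    ∫ x, (x j * ∑ l, x l * β l) ^ 2 ∂rowLaw n p ≤ 64 * (∑ l, β l ^ 2) / n ^ 2 := by
  set B := ∑ l, β l ^ 2 with hB
  rcases (show 0 ≤ B by positivity).eq_or_lt with h0 | h0
  · have hβ : ∀ l, β l = 0 := by
      have := (Finset.sum_eq_zero_iff_of_nonneg (s := Finset.univ) (f := fun l => β l ^ 2)
        fun l _ => sq_nonneg _).1 h0.symm
      simpa using this
    simp [hβ, ← h0]
  · have hx : Integrable (fun x : Fin p → ℝ => x j ^ 4) (rowLaw n p) := by
      simpa [Even.pow_abs (show Even 4 by decide)] using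
        (memLp_eval_rowLaw n j (q := 4) (by simp)).integrable_norm_pow'
    have hU : Integrable (fun x : Fin p → ℝ => (∑ l, x l * β l) ^ 4) (rowLaw n p) := by
      simpa [Even.pow_abs (show Even 4 by decide)] using
        (memLp_linear_rowLaw n β (q := 4) (by simp)).integrable_norm_pow'
    calc _ ≤ ∫ x, (B / 2 * x j ^ 4 + (2 * B)⁻¹ * (∑ l, x l * β l) ^ 4) ∂rowLaw n p := by
          refine integral_mono_of_nonneg (ae_of_all _ fun x => sq_nonneg _)
            ((hx.const_mul _).add (hU.const_mul _)) (ae_of_all _ fun x => ?_)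
          have h : B / 2 * x j ^ 4 + (2 * B)⁻¹ * (∑ l, x l * β l) ^ 4 -
              (x j * ∑ l, x l * β l) ^ 2 =
              (2 * B)⁻¹ * (B * x j ^ 2 - (∑ l, x l * β l) ^ 2) ^ 2 := by
            field_simp
            ring
          have : 0 ≤ (2 * B)⁻¹ * (B * x j ^ 2 - (∑ l, x l * β l) ^ 2) ^ 2 := by positivity
          simp only
          linarith
      _ = B / 2 * ∫ x, x j ^ 4 ∂rowLaw n p +
          (2 * B)⁻¹ * ∫ x, (∑ l, x l * β l) ^ 4 ∂rowLaw n p := by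
          rw [integral_add (hx.const_mul _) (hU.const_mul _), integral_const_mul,
            integral_const_mul]
      _ ≤ B / 2 * (64 * ((n : ℝ)⁻¹) ^ 2) + (2 * B)⁻¹ * (64 * (B / n) ^ 2) := by
          gcongr
          · exact integral_eval_pow_four_rowLaw_le n j
          · exact integral_linear_pow_four_rowLaw_le n β
      _ = _ := by field_simp; ring

lemma memLp_eval_mul_linear_rowLaw (β : Fin p → ℝ) (j : Fin p) :
    MemLp (fun x : Fin p → ℝ => x j * ∑ l, x l * β l) 2 (rowLaw n p) := by
  have : ENNReal.HolderTriple 4 4 2 := ⟨by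
    rw [show (4 : ℝ≥0∞) = 2 * 2 by norm_num, ENNReal.mul_inv (by simp) (by simp), ← mul_add,
      ENNReal.inv_two_add_inv_two, mul_one]⟩
  exact (memLp_linear_rowLaw n β (q := 4) (by simp)).mul'
    (memLp_eval_rowLaw n j (q := 4) (by simp))

end rowLaw

section observation

variable (n : ℕ) {p : ℕ}

/-- The law of one row of the design matrix together with the corresponding noise variable. -/
def observationLaw (n p : ℕ) : Measure ((Fin p → ℝ) × ℝ) :=
  (rowLaw n p).prod (gaussianReal 0 1)

instance : IsProbabilityMeasure (observationLaw n p) := by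
  unfold observationLaw; infer_instance

lemma memLp_eval_mul_noise (j : Fin p) :
    MemLp (fun q : (Fin p → ℝ) × ℝ => q.1 j * q.2) 2 (observationLaw n p) := by
  rw [memLp_two_iff_integrable_sq (by fun_prop)]
  simp_rw [mul_pow]
  exact (memLp_eval_rowLaw n j (q := 2) (by simp)).integrable_sq.mul_prod
    (memLp_id_gaussianReal 2).integrable_sq

lemma memLp_eval_mul_response (β : Fin p → ℝ) (σ : ℝ) (j : Fin p) :
    MemLp (fun q : (Fin p → ℝ) × ℝ => q.1 j * ((∑ l, q.1 l * β l) + σ * q.2)) 2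
      (observationLaw n p) := by
  have h1 := (memLp_eval_mul_linear_rowLaw n β j).comp_measurePreserving
    (measurePreserving_fst (μ := rowLaw n p) (ν := gaussianReal 0 1))
  refine (h1.add ((memLp_eval_mul_noise n j).const_mul σ)).ae_eq (ae_of_all _ fun q => ?_)
  simp only [Pi.add_apply, Function.comp_apply]
  ring

lemma integral_eval_mul_response (β : Fin p → ℝ) (σ : ℝ) (j : Fin p) :
    ∫ q, q.1 j * ((∑ l, q.1 l * β l) + σ * q.2) ∂observationLaw n p = β j / n := by
  have h1 : Integrable (fun q : (Fin p → ℝ) × ℝ => q.1 j * ∑ l, q.1 l * β l)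
      (observationLaw n p) :=
    ((memLp_eval_mul_linear_rowLaw n β j).integrable one_le_two).comp_fst _
  have h2 := ((memLp_eval_mul_noise n j).integrable one_le_two).const_mul σ
  calc _ = ∫ q, (q.1 j * ∑ l, q.1 l * β l) + σ * (q.1 j * q.2) ∂observationLaw n p := by
        refine integral_congr_ae (ae_of_all _ fun q => ?_)
        simp only
        ring
    _ = _ := by
        rw [integral_add h1 h2, integral_const_mul, observationLaw,
          integral_prod_mul (fun x : Fin p → ℝ => x j) (fun z : ℝ => z),
          integral_eval_rowLaw, integral_fun_fst (fun x : Fin p → ℝ => x j * ∑ l, x l * β l),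
          integral_eval_mul_linear_rowLaw]
        simp

lemma integral_eval_mul_response_sq_le (β : Fin p → ℝ) (σ : ℝ) (j : Fin p) :
    ∫ q, (q.1 j * ((∑ l, q.1 l * β l) + σ * q.2)) ^ 2 ∂observationLaw n p ≤
      64 * (∑ l, β l ^ 2) / n ^ 2 + σ ^ 2 / n := by
  have h1 : MemLp (fun q : (Fin p → ℝ) × ℝ => q.1 j * ∑ l, q.1 l * β l) 2
      (observationLaw n p) :=
    (memLp_eval_mul_linear_rowLaw n β j).comp_measurePreserving
      (measurePreserving_fst (μ := rowLaw n p) (ν := gaussianReal 0 1))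
  have h2 := (memLp_eval_mul_noise n j)
  have hcross : ∫ q, (q.1 j * ∑ l, q.1 l * β l) * (q.1 j * q.2) ∂observationLaw n p = 0 := by
    have := integral_prod_mul (μ := rowLaw n p) (ν := gaussianReal 0 1)
      (fun x : Fin p → ℝ => (x j * ∑ l, x l * β l) * x j) (fun z : ℝ => z)
    rw [integral_id_gaussianReal, mul_zero] at this
    rw [← this, observationLaw]
    simp_rw [mul_assoc]
  have hnoise : ∫ q, (q.1 j * q.2) ^ 2 ∂observationLaw n p = (n : ℝ)⁻¹ := by
    have hz : ∫ z, z ^ 2 ∂gaussianReal 0 1 = 1 := by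
      have h := variance_id_gaussianReal (μ := 0) (v := 1)
      rw [variance_eq_sub (memLp_id_gaussianReal 2)] at h
      simpa using h
    simp_rw [mul_pow]
    rw [observationLaw, integral_prod_mul (fun x : Fin p → ℝ => x j ^ 2) (fun z : ℝ => z ^ 2),
      integral_eval_sq_rowLaw, hz, mul_one]
  calc _ = ∫ q, ((q.1 j * ∑ l, q.1 l * β l) ^ 2 +
        2 * σ * ((q.1 j * ∑ l, q.1 l * β l) * (q.1 j * q.2))) + σ ^ 2 * (q.1 j * q.2) ^ 2
          ∂observationLaw n p := by
        refine integral_congr_ae (ae_of_all _ fun q => ?_)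
        simp only
        ring
    _ = ∫ x, (x j * ∑ l, x l * β l) ^ 2 ∂rowLaw n p + σ ^ 2 / n := by
        have h3 : Integrable (fun q : (Fin p → ℝ) × ℝ =>
            2 * σ * ((q.1 j * ∑ l, q.1 l * β l) * (q.1 j * q.2))) (observationLaw n p) :=
          (h1.integrable_mul h2).const_mul (2 * σ)
        have h4 := h2.integrable_sq.const_mul (σ ^ 2)
        have h5 := h1.integrable_sq.fun_add h3
        rw [integral_add h5 h4, integral_add h1.integrable_sq h3,
          integral_const_mul, integral_const_mul, hcross, hnoise, observationLaw,
          integral_fun_fst (fun x : Fin p → ℝ => (x j * ∑ l, x l * β l) ^ 2)]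
        simp [div_eq_mul_inv]
    _ ≤ _ := by
        gcongr
        exact integral_eval_mul_linear_sq_rowLaw_le n β j

end observation

section upperBound

variable {n p : ℕ}

/-- The rescaled correlation estimator `c Xᵀ y`. -/
def correlationEstimator (n p : ℕ) (c : ℝ) (q : (Fin n → Fin p → ℝ) × (Fin n → ℝ)) :
    Fin p → ℝ :=
  fun j => c * ∑ i, q.1 i j * q.2 i

lemma measurable_correlationEstimator (c : ℝ) : Measurable (correlationEstimator n p c) := by
  unfold correlationEstimator
  fun_prop

lemma integral_correlation_sub_sq_le (hn : 0 < n) (c : ℝ) (β : Fin p → ℝ) (σ : ℝ) (j : Fin p) :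
    Integrable (fun ω : Fin n → (Fin p → ℝ) × ℝ =>
      (c * ∑ i, (ω i).1 j * ((∑ l, (ω i).1 l * β l) + σ * (ω i).2) - β j) ^ 2)
        (Measure.pi fun _ => observationLaw n p) ∧
    ∫ ω : Fin n → (Fin p → ℝ) × ℝ,
      (c * ∑ i, (ω i).1 j * ((∑ l, (ω i).1 l * β l) + σ * (ω i).2) - β j) ^ 2
        ∂(Measure.pi fun _ => observationLaw n p) ≤
      (1 - c) ^ 2 * β j ^ 2 + c ^ 2 * (64 * (∑ l, β l ^ 2) / n + σ ^ 2) := by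
  have hn' : (0 : ℝ) < n := by exact_mod_cast hn
  set h : (Fin p → ℝ) × ℝ → ℝ := fun q => q.1 j * ((∑ l, q.1 l * β l) + σ * q.2) with hh
  set P : Measure (Fin n → (Fin p → ℝ) × ℝ) := Measure.pi fun _ => observationLaw n p with hP
  have hL : MemLp h 2 (observationLaw n p) := memLp_eval_mul_response n β σ j
  have hi : ∀ i : Fin n, MemLp (fun ω : Fin n → (Fin p → ℝ) × ℝ => h (ω i)) 2 P := fun i =>
    hL.comp_measurePreserving (measurePreserving_eval (fun _ : Fin n => observationLaw n p) i)
  have hT : MemLp (fun ω : Fin n → (Fin p → ℝ) × ℝ => ∑ i, h (ω i)) 2 P :=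
    memLp_finsetSum _ fun i _ => hi i
  have hS : MemLp (fun ω : Fin n → (Fin p → ℝ) × ℝ => c * ∑ i, h (ω i) - β j) 2 P :=
    (hT.const_mul c).sub (memLp_const _)
  refine ⟨hS.integrable_sq, ?_⟩
  have hmean : ∫ ω, (c * ∑ i, h (ω i) - β j) ∂P = (c - 1) * β j := by
    rw [integral_sub ((hT.const_mul c).integrable one_le_two) (integrable_const _),
      integral_const_mul, integral_finsetSum _ fun i _ => (hi i).integrable one_le_two]
    have : ∀ i : Fin n, ∫ ω, h (ω i) ∂P = β j / n := fun i => by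
      rw [hP, integral_comp_eval (μ := fun _ : Fin n => observationLaw n p)
        hL.aestronglyMeasurable]
      exact integral_eval_mul_response n β σ j
    simp only [this, Finset.sum_const, Finset.card_univ, Fintype.card_fin, nsmul_eq_mul,
      integral_const, probReal_univ, one_smul]
    field_simp
  have hvar : Var[fun ω => c * ∑ i, h (ω i) - β j; P] ≤
      c ^ 2 * (64 * (∑ l, β l ^ 2) / n + σ ^ 2) := by
    rw [variance_sub_const (hT.const_mul c).aestronglyMeasurable, variance_const_mul]
    refine mul_le_mul_of_nonneg_left ?_ (sq_nonneg c)
    have hsum := variance_sum_pi (μ := fun _ : Fin n => observationLaw n p)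
      (X := fun _ => h) fun _ => hL
    have hfun : (∑ i : Fin n, fun ω : Fin n → (Fin p → ℝ) × ℝ => h (ω i)) =
        fun ω => ∑ i, h (ω i) := by
      ext ω; simp
    rw [hfun] at hsum
    rw [hP, hsum, Finset.sum_const, Finset.card_univ, Fintype.card_fin, nsmul_eq_mul]
    calc _ ≤ (n : ℝ) * (64 * (∑ l, β l ^ 2) / n ^ 2 + σ ^ 2 / n) := by
          gcongr
          exact (variance_le_expectation_sq hL.aestronglyMeasurable).trans
            (integral_eval_mul_response_sq_le n β σ j)
      _ = _ := by field_simp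
  rw [variance_eq_sub hS, hmean] at hvar
  simp only [Pi.pow_apply] at hvar
  linarith

lemma risk_correlationEstimator_le (hn : 0 < n) (c : ℝ) (β : Fin p → ℝ) (σ : ℝ) :
    risk n p σ (correlationEstimator n p c) β ≤
      ENNReal.ofReal ((1 - c) ^ 2 * ∑ j, β j ^ 2 +
        c ^ 2 * (64 * (p / n) * ∑ j, β j ^ 2 + p * σ ^ 2)) := by
  have hmp := measurePreserving_arrowProdEquivProdArrow (Fin p → ℝ) ℝ (Fin n)
    (fun _ => rowLaw n p) (fun _ => gaussianReal 0 1)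
  have h : risk n p σ (correlationEstimator n p c) β =
      ∫⁻ ω : Fin n → (Fin p → ℝ) × ℝ, ENNReal.ofReal (∑ j,
        (c * ∑ i, (ω i).1 j * ((∑ l, (ω i).1 l * β l) + σ * (ω i).2) - β j) ^ 2)
          ∂(Measure.pi fun _ => observationLaw n p) := by
    unfold risk
    exact (hmp.lintegral_comp_emb (MeasurableEquiv.measurableEmbedding _) _).symm
  have hI := fun j => integral_correlation_sub_sq_le hn c β σ j
  rw [h, ← ofReal_integral_eq_lintegral_ofReal (integrable_finsetSum _ fun j _ => (hI j).1)
    (ae_of_all _ fun ω => Finset.sum_nonneg fun _ _ => sq_nonneg _),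
    integral_finsetSum _ fun j _ => (hI j).1]
  refine ENNReal.ofReal_le_ofReal ((Finset.sum_le_sum fun j _ => (hI j).2).trans_eq ?_)
  rw [Finset.sum_add_distrib, ← Finset.mul_sum, Finset.sum_const, Finset.card_univ,
    Fintype.card_fin, nsmul_eq_mul]
  ring

/-- Upper bound on the minimax risk from the optimally rescaled correlation estimator. -/
theorem minimaxRisk_le (hn : 0 < n) {k : ℕ} (hk : 0 < k) {τ σ : ℝ} (hτ : 0 < τ) :
    minimaxRisk n p k τ σ ≤ ENNReal.ofReal (k * τ ^ 2 *
      (1 - (1 + 64 * (p / n) + p * σ ^ 2 / (k * τ ^ 2))⁻¹)) := by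
  set s : ℝ := 64 * (p / n) + p * σ ^ 2 / (k * τ ^ 2) with hs
  have hs0 : 0 ≤ s := by positivity
  unfold _root_.minimaxRisk
  refine iInf₂_le_of_le _ (measurable_correlationEstimator (1 + s)⁻¹) (iSup₂_le fun β hβ => ?_)
  refine (risk_correlationEstimator_le hn _ β σ).trans (ENNReal.ofReal_le_ofReal ?_)
  calc _ ≤ (1 - (1 + s)⁻¹) ^ 2 * (k * τ ^ 2) +
        (1 + s)⁻¹ ^ 2 * (64 * (p / n) * (k * τ ^ 2) + p * σ ^ 2) := by
        gcongr
        · exact hβ.2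
        · exact hβ.2
    _ = (k * τ ^ 2) * ((1 - (1 + s)⁻¹) ^ 2 + (1 + s)⁻¹ ^ 2 * s) := by
        have : (k * τ ^ 2) * s = 64 * (p / n) * (k * τ ^ 2) + p * σ ^ 2 := by
          rw [hs]
          field_simp
        rw [← this]
        ring
    _ = _ := by
        rw [add_assoc, ← hs]
        field_simp
        ring

end upperBound

lemma one_sub_toReal_minimaxRisk_bounds {n p k : ℕ} (hn : 2 ≤ n) (hk : 0 < k) (hkp : k < p)
    {τ σ : ℝ} (hτ : 0 < τ) (hσ : 0 < σ) (ha : 2 * (τ / σ) ^ 2 < 1) :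
    (k / p * (τ / σ) ^ 2 + 64 * (k / n) * (τ / σ) ^ 2 + 1)⁻¹ ≤
        (1 - (minimaxRisk n p k τ σ).toReal / (k * τ ^ 2)) * ((p * σ ^ 2) / (k * τ ^ 2)) ∧
      (1 - (minimaxRisk n p k τ σ).toReal / (k * τ ^ 2)) * ((p * σ ^ 2) / (k * τ ^ 2)) ≤
        ((1 - k / p) * (1 - 2 * (τ / σ) ^ 2))⁻¹ := by
  have hk' : (0 : ℝ) < k := by exact_mod_cast hk
  have hp' : (0 : ℝ) < p := by exact_mod_cast hk.trans hkp
  have hn' : (0 : ℝ) < n := by exact_mod_cast (by omega : 0 < n)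
  have hkp' : (k : ℝ) < p := by exact_mod_cast hkp
  have hm : 0 < p / k := Nat.div_pos hkp.le hk
  have hm' : (0 : ℝ) < (p / k : ℕ) := by exact_mod_cast hm
  have hup := minimaxRisk_le (n := n) (p := p) (by omega) hk (σ := σ) hτ
  have hlow := minimaxRisk_ge hn hm (Nat.mul_div_le p k) hσ ha
  have hR : minimaxRisk n p k τ σ ≠ ∞ := ne_top_of_le_ne_top ENNReal.ofReal_ne_top hup
  set R := (minimaxRisk n p k τ σ).toReal with hRdef
  set K : ℝ := k * τ ^ 2 with hK
  have hK0 : 0 < K := by positivity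
  have hup' : R ≤ K * (1 - (1 + 64 * (p / n) + p * σ ^ 2 / K)⁻¹) := by
    refine ENNReal.toReal_le_of_le_ofReal (mul_nonneg hK0.le (sub_nonneg.2 ?_)) hup
    refine inv_le_one_of_one_le₀ ?_
    have : 0 ≤ 64 * ((p : ℝ) / n) + p * σ ^ 2 / K := by positivity
    linarith
  have hlow' := (ENNReal.ofReal_le_iff_le_toReal hR).1 hlow
  have hq0 : 0 < p * σ ^ 2 / K := by positivity
  constructor
  · calc _ = (1 + 64 * (p / n) + p * σ ^ 2 / K)⁻¹ * (p * σ ^ 2 / K) := by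
          rw [hK]
          field_simp
      _ ≤ _ := by
          refine mul_le_mul_of_nonneg_right ?_ hq0.le
          rw [le_sub_comm, div_le_iff₀' hK0]
          exact hup'
  · have h1 : 0 < 1 - 2 * (τ / σ) ^ 2 := by linarith
    have h2 : (0 : ℝ) < 1 - k / p := by
      rw [sub_pos, div_lt_one hp']
      exact hkp'
    have hfloor : (1 - k / p : ℝ) ≤ k * (p / k : ℕ) / p := by
      have : (p : ℝ) ≤ k * (p / k : ℕ) + k := by
        exact_mod_cast (by have := Nat.lt_mul_div_succ p hk; rw [mul_add, mul_one] at this; omega)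
      rw [le_div_iff₀ hp', sub_mul, one_mul, div_mul_cancel₀ _ hp'.ne']
      linarith
    calc _ ≤ (τ / σ) ^ 2 / ((p / k : ℕ) * (1 - 2 * (τ / σ) ^ 2)) * (p * σ ^ 2 / K) := by
          refine mul_le_mul_of_nonneg_right ?_ hq0.le
          rw [sub_le_comm, le_div_iff₀' hK0]
          exact hlow'
      _ = (k * (p / k : ℕ) / p * (1 - 2 * (τ / σ) ^ 2))⁻¹ := by
          have hne := h1.ne'
          generalize hb : 1 - 2 * (τ / σ) ^ 2 = b at hne ⊢
          rw [hK]
          field_simp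
      _ ≤ _ := by gcongr

/-- **Theorem 3 (second-order minimax risk in Regime I), minimax-risk part.**
If `k/p → 0`, `k/n → 0` and `τ/σ → 0`, then
`R(Θ(k,τ),σ) = k τ² (1 − (k τ²/(p σ²)) (1 + o(1)))`, i.e.
`(1 − R/(k τ²)) · (p σ²/(k τ²)) → 1`. -/
theorem regimeI_second_order_minimax
    (k p : ℕ → ℕ) (τ σ : ℕ → ℝ)
    (hk : ∀ n, 0 < k n) (hkp : ∀ n, k n ≤ p n)
    (hτ : ∀ n, 0 < τ n) (hσ : ∀ n, 0 < σ n)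
    (hkp0 : Tendsto (fun n => (k n : ℝ) / p n) atTop (nhds 0))
    (hkn0 : Tendsto (fun n => (k n : ℝ) / n) atTop (nhds 0))
    (hμ : Tendsto (fun n => τ n / σ n) atTop (nhds 0)) :
    Tendsto (fun n =>
        (1 - (minimaxRisk n (p n) (k n) (τ n) (σ n)).toReal / (k n * τ n ^ 2)) *
          ((p n * σ n ^ 2) / (k n * τ n ^ 2)))
      atTop (nhds 1) := by
  have ha : Tendsto (fun n => (τ n / σ n) ^ 2) atTop (nhds 0) := by simpa using hμ.pow 2
  have hlow : Tendsto (fun n : ℕ => ((k n : ℝ) / p n * (τ n / σ n) ^ 2 +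
      64 * ((k n : ℝ) / n) * (τ n / σ n) ^ 2 + 1)⁻¹) atTop (nhds 1) := by
    simpa using
      (((hkp0.mul ha).add ((hkn0.const_mul 64).mul ha)).add_const 1).inv₀ (by norm_num)
  have hup : Tendsto (fun n : ℕ => ((1 - (k n : ℝ) / p n) *
      (1 - 2 * (τ n / σ n) ^ 2))⁻¹) atTop (nhds 1) := by
    simpa using ((hkp0.const_sub 1).mul ((ha.const_mul 2).const_sub 1)).inv₀ (by norm_num)
  have hbounds : ∀ᶠ n in atTop, 2 ≤ n ∧ k n < p n ∧ 2 * (τ n / σ n) ^ 2 < 1 := by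
    filter_upwards [eventually_ge_atTop 2, hkp0.eventually (gt_mem_nhds one_pos),
      ha.eventually (gt_mem_nhds one_half_pos)] with n hn hr ha
    refine ⟨hn, ?_, by linarith⟩
    have hp : (0 : ℝ) < p n := by exact_mod_cast (hk n).trans_le (hkp n)
    exact_mod_cast (div_lt_one hp).1 hr
  refine tendsto_of_tendsto_of_tendsto_of_le_of_le' hlow hup ?_ ?_
  · filter_upwards [hbounds] with n ⟨hn, hr, ha⟩
    exact (one_sub_toReal_minimaxRisk_bounds hn (hk n) hr (hτ n) (hσ n) ha).1
  · filter_upwards [hbounds] with n ⟨hn, hr, ha⟩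
    exact (one_sub_toReal_minimaxRisk_bounds hn (hk n) hr (hτ n) (hσ n) ha).2
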